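/- If i ∈ J, then 0 < ξ_i < p²·(p^f − 1)/(p − 1). -/

import Mathlib

open Finset in
/-- The Horner recursion for a polynomial value listed from its leading coefficient. -/
theorem sum_range_succ_mul_pow_sub (a : ℕ → ℤ) (p : ℤ) (n : ℕ) :
    ∑ j ∈ range (n + 1), a j * p ^ (n + 1 - 1 - j)
      = p * ∑ j ∈ range n, a j * p ^ (n - 1 - j) + a n := by
  rw [sum_range_succ, mul_sum]
  congr 1
  · refine sum_congr rfl fun j hj => ?_
    have hj' : n + 1 - 1 - j = (n - 1 - j) + 1 := by
      have := mem_range.mp hj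
      omega
    rw [hj', pow_succ]
    ring
  · simp

/-- A periodic predicate that holds on a full period holds everywhere. -/
theorem forall_of_periodic_of_forall_lt {Q : ℤ → Prop} {f : ℕ} (hf : 1 ≤ f)
    (hQ : ∀ i, Q (i + f) = Q i) (i : ℤ) (h : ∀ k : ℕ, k < f → Q (i + k)) (m : ℤ) : Q m := by
  have hper : Function.Periodic Q (f : ℤ) := hQ
  have hf' : (0 : ℤ) < f := by omega
  have h0 := Int.emod_nonneg (m - i) hf'.ne'
  have h1 := Int.emod_lt_of_pos (m - i) hf'
  have h2 := Int.emod_add_mul_ediv (m - i) f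
  have h3 := h ((m - i) % f).toNat (by omega)
  rw [Int.toNat_of_nonneg h0] at h3
  rw [← hper.sub_zsmul_eq ((m - i) / f)]
  convert h3 using 1
  rw [smul_eq_mul]
  linarith [mul_comm ((m - i) / (f : ℤ)) f]

/-- A Horner sequence with positive initial value and digits at least `-p` stays positive as long
as the pattern `1, -(p - 1), …, -(p - 1), -p` does not occur as an initial segment. -/
theorem pos_of_horner {p : ℤ} (hp : 2 ≤ p) {S a : ℕ → ℤ} (hS : ∀ k, S (k + 1) = p * S k + a k)
    (h0 : 1 ≤ S 0) (ha : ∀ k, -p ≤ a k) (n : ℕ)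
    (hpat : ∀ k < n, S 0 = 1 → (∀ j < k, a j = -(p - 1)) → a k ≠ -p) : 0 < S n := by
  have key : ∀ k ≤ n, 2 ≤ S k ∨ (S k = 1 ∧ S 0 = 1 ∧ ∀ j < k, a j = -(p - 1)) := by
    intro k
    induction k with
    | zero =>
      intro _
      rcases h0.lt_or_eq with h | h
      · left; omega
      · right; exact ⟨h.symm, h.symm, by simp⟩
    | succ k ih =>
      intro hk
      have hak := ha k
      rcases ih (by omega) with h | ⟨h, h1, h2⟩
      · left
        rw [hS]
        nlinarith
      · have hne := hpat k (by omega) h1 h2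
        rw [hS, h]
        by_cases hk' : a k = -(p - 1)
        · right
          refine ⟨by linarith, h1, fun j hj => ?_⟩
          rcases Nat.lt_succ_iff_lt_or_eq.mp hj with hj | rfl
          exacts [h2 j hj, hk']
        · left
          omega
  rcases key n le_rfl with h | ⟨h, -⟩ <;> omega

/-- A Horner sequence with initial value and digits at most `p` is bounded by `p` times a geometric
sum, with equality only if the initial value and all digits equal `p`. -/
theorem horner_lt_or_eq {p : ℤ} (hp : 0 < p) {S a : ℕ → ℤ} (hS : ∀ k, S (k + 1) = p * S k + a k)
    (h0 : S 0 ≤ p) (ha : ∀ k, a k ≤ p) (n : ℕ) :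
    S n < p * ∑ j ∈ Finset.range (n + 1), p ^ j ∨ (S 0 = p ∧ ∀ j < n, a j = p) := by
  suffices S n < p * ∑ j ∈ Finset.range (n + 1), p ^ j ∨
      (S n = p * ∑ j ∈ Finset.range (n + 1), p ^ j ∧ S 0 = p ∧ ∀ j < n, a j = p) from
    this.imp_right And.right
  induction n with
  | zero =>
    rcases h0.lt_or_eq with h | h
    · left; simpa using h
    · right; simpa using h
  | succ n ih =>
    have hak := ha n
    rw [hS, geom_sum_succ]
    rcases ih with h | ⟨h, h1, h2⟩
    · left
      have := mul_lt_mul_of_pos_left h hp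
      linarith
    · rcases hak.lt_or_eq with hlt | heq
      · left
        rw [h]
        linarith
      · right
        refine ⟨by rw [h, heq]; ring, h1, fun j hj => ?_⟩
        rcases Nat.lt_succ_iff_lt_or_eq.mp hj with hj | rfl
        exacts [h2 j hj, heq]


open scoped Classical in
/-- Lemma 3.10 ("bounds on xi"): if `i ∈ J` then `0 < ξ_i < p² (p^f - 1)/(p - 1)`,
where `(p^f - 1)/(p - 1)` is written as the geometric sum `∑_{j<f} p^j`. -/
theorem stmt_2 (p f : ℕ) (hp : p.Prime) (hf : 1 ≤ f)
    (r : ℤ → ℤ) (hr_per : ∀ i : ℤ, r (i + f) = r i)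
    (hr_lb : ∀ i : ℤ, 1 ≤ r i) (hr_ub : ∀ i : ℤ, r i ≤ p)
    (J : Set ℤ) (hJ_per : ∀ i : ℤ, i ∈ J ↔ i + f ∈ J)
    (xi : ℤ → ℤ)
    (hxi : ∀ i : ℤ, xi i =
      (∑ j ∈ Finset.range f,
        (if (i + j + 1 : ℤ) ∈ J then (1 : ℤ) else -1) * r (i + j + 1) * (p : ℤ) ^ (f - 1 - j))
      + (if i ∈ J then r i * ((p : ℤ) ^ f - 1) else 0))
    (hmax₁ : ∀ i j : ℤ, j < i → r j = 1 → (∀ k : ℤ, j < k → k < i → r k = p - 1) →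
      r i = p → (∀ k : ℤ, j < k → k ≤ i → k ∉ J) → j ∉ J)
    (hmax₂ : ((∀ i : ℤ, r i = p - 1) ∨ (p = 2 ∧ ∀ i : ℤ, r i = 2)) → J.Nonempty)
    (hJ_ne_univ : (∀ i : ℤ, r i = p) → J ≠ Set.univ) :
    ∀ i ∈ J, 0 < xi i ∧ xi i < (p : ℤ) ^ 2 * ∑ j ∈ Finset.range f, (p : ℤ) ^ j := by
  intro i hi
  obtain ⟨n, rfl⟩ : ∃ n, f = n + 1 := ⟨f - 1, by omega⟩
  have hp2 : (2 : ℤ) ≤ p := by exact_mod_cast hp.two_le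
  set a : ℕ → ℤ := fun j => (if (i + j + 1 : ℤ) ∈ J then (1 : ℤ) else -1) * r (i + j + 1) with ha
  have ha_mem : ∀ j : ℕ, (i + j + 1 : ℤ) ∈ J → a j = r (i + j + 1) := fun j hj => by simp [ha, hj]
  have ha_notMem : ∀ j : ℕ, (i + j + 1 : ℤ) ∉ J → a j = -r (i + j + 1) := fun j hj => by
    simp [ha, hj]
  have ha_lb : ∀ j, -(p : ℤ) ≤ a j := fun j => by
    have h1 := hr_lb (i + j + 1)
    have h2 := hr_ub (i + j + 1)
    by_cases hj : (i + j + 1 : ℤ) ∈ J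
    · rw [ha_mem j hj]; omega
    · rw [ha_notMem j hj]; omega
  have ha_ub : ∀ j, a j ≤ p := fun j => by
    have h1 := hr_lb (i + j + 1)
    have h2 := hr_ub (i + j + 1)
    by_cases hj : (i + j + 1 : ℤ) ∈ J
    · rw [ha_mem j hj]; omega
    · rw [ha_notMem j hj]; omega
  have ha_neg : ∀ j, a j < 0 → (i + j + 1 : ℤ) ∉ J ∧ r (i + j + 1) = -a j := fun j hj => by
    have h1 := hr_lb (i + j + 1)
    by_cases hmem : (i + j + 1 : ℤ) ∈ J
    · rw [ha_mem j hmem] at hj; omega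
    · exact ⟨hmem, by rw [ha_notMem j hmem]; ring⟩
  have ha_eq : ∀ j, a j = p → (i + j + 1 : ℤ) ∈ J ∧ r (i + j + 1) = p := fun j hj => by
    have h1 := hr_lb (i + j + 1)
    by_cases hmem : (i + j + 1 : ℤ) ∈ J
    · exact ⟨hmem, by rw [← ha_mem j hmem, hj]⟩
    · rw [ha_notMem j hmem] at hj; omega
  set S : ℕ → ℤ := fun k =>
    r i * (p : ℤ) ^ k + ∑ j ∈ Finset.range k, a j * (p : ℤ) ^ (k - 1 - j) with hSdef
  have hS : ∀ k, S (k + 1) = p * S k + a k := fun k => by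
    simp only [hSdef, sum_range_succ_mul_pow_sub]
    ring
  have hS0 : S 0 = r i := by simp [hSdef]
  have han : a n = r i := by
    have hcast : (i + n + 1 : ℤ) = i + ((n + 1 : ℕ) : ℤ) := by push_cast; ring
    rw [ha_mem n (by rw [hcast]; exact (hJ_per i).mp hi), hcast, hr_per]
  have hxiS : xi i = p * S n := by
    have h := hS n
    rw [hxi i, if_pos hi]
    simp only [hSdef] at h ⊢
    rw [han] at h
    linarith
  rw [hxiS]
  constructor
  · refine mul_pos (by omega) (pos_of_horner hp2 hS (hS0 ▸ hr_lb i) ha_lb n ?_)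
    intro k _ h1 hlt hk
    have hlt' : ∀ m : ℤ, i < m → m < i + k + 1 → m ∉ J ∧ r m = p - 1 := by
      intro m hm hmk
      obtain ⟨j, rfl⟩ : ∃ j : ℕ, m = i + j + 1 := ⟨(m - i - 1).toNat, by omega⟩
      have hj := hlt j (by omega)
      obtain ⟨h3, h4⟩ := ha_neg j (by omega)
      exact ⟨h3, by omega⟩
    obtain ⟨h3, h4⟩ := ha_neg k (by omega)
    refine hmax₁ (i + k + 1) i (by omega) (hS0 ▸ h1) (fun m hm hmk => (hlt' m hm hmk).2)
      (by omega) (fun m hm hmk => ?_) hi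
    rcases hmk.lt_or_eq with h | rfl
    exacts [(hlt' m hm h).1, h3]
  · rcases horner_lt_or_eq (by omega) hS (hS0 ▸ hr_ub i) ha_ub n with h | ⟨h1, h2⟩
    · rw [sq, mul_assoc]
      exact mul_lt_mul_of_pos_left h (by omega)
    · exfalso
      have hall : ∀ m : ℤ, m ∈ J ∧ r m = p := by
        refine forall_of_periodic_of_forall_lt hf
          (fun m => by rw [hr_per, ← hJ_per]) i fun k hk => ?_
        rcases k with _ | k
        · simpa using ⟨hi, hS0 ▸ h1⟩
        · have := ha_eq k (h2 k (by omega))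
          push_cast
          rwa [← add_assoc]
      exact hJ_ne_univ (fun m => (hall m).2) (Set.eq_univ_of_forall fun m => (hall m).1)
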